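/- Let q = p^m with p prime, let P be a polynomial of degree n over F_q with reciprocal polynomial P* satisfying P*(0) ≠ 0, let δ be a nonzero element of the prime field F_p ⊆ F_q, and define F₀(x) = P*(x) and F_u(x) = (x^p − x + δ)^{n·p^{u−1}} · F_{u−1}((x^p − x)/(x^p − x + δ)) for u ≥ 1. Then for every u ≥ 1, Tr_{q|p}( F_u′(1)/F_u(1) ) = (−1)^{u−1}·δ^{−(u−1)}·Tr_{q|p}( F₁′(1)/F₁(1) ). -/

import Mathlib

open Polynomial

/-- The trace map `Tr_{q|p} : F_q → F_p ⊆ F_q`, `Tr(x) = ∑_{i=0}^{m-1} x^{p^i}`,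
valued in `F` (its image lies in the prime field). -/
def TrQP {F : Type*} [Field F] (p m : ℕ) (x : F) : F :=
  ∑ i ∈ Finset.range m, x ^ p ^ i

/-- `(x^p - x + δ)^t · G((x^p - x)/(x^p - x + δ))` for `G` of degree `t`, i.e.
`∑_{i=0}^t g_i (x^p - x)^i (x^p - x + δ)^{t-i}` where `G = ∑ g_i x^i`. -/
noncomputable def compSubstAS {F : Type*} [Field F] (p : ℕ) (δ : F) (t : ℕ)
    (G : Polynomial F) : Polynomial F :=
  ∑ i ∈ Finset.range (t + 1), Polynomial.C (G.coeff i) *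
    (X ^ p - X) ^ i * (X ^ p - X + C δ) ^ (t - i)

/-- The sequence `F₀ = P*`, `F_u = (x^p-x+δ)^{n·p^{u-1}} F_{u-1}((x^p-x)/(x^p-x+δ))`. -/
noncomputable def FseqAS {F : Type*} [Field F] (p : ℕ) (δ : F) (n : ℕ)
    (P0 : Polynomial F) : ℕ → Polynomial F
  | 0 => P0
  | u + 1 => compSubstAS p δ (n * p ^ u) (FseqAS p δ n P0 u)

theorem cs_eval {F : Type*} [Field F] (p : ℕ) (δ : F) (t : ℕ) (G : Polynomial F) (a : F)
    (ha : a ^ p = a) : (compSubstAS p δ t G).eval a = G.coeff 0 * δ ^ t := by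
  unfold compSubstAS
  rw [Finset.sum_range_succ']
  simp [eval_finsetSum, ha]

theorem cs_deriv {F : Type*} [Field F] (p : ℕ) [CharP F p] (δ : F) (s : ℕ)
    (hs : ((s + 1 : ℕ) : F) = 0) (G : Polynomial F) (a : F)
    (ha : a ^ p = a) :
    (derivative (compSubstAS p δ (s + 1) G)).eval a = - (G.coeff 1 * δ ^ s) := by
  have hs' : (s : F) + 1 = 0 := by exact_mod_cast hs
  unfold compSubstAS
  rw [Finset.sum_range_succ', Finset.sum_range_succ']
  simp [eval_finsetSum, ha, derivative_pow, hs']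

theorem cs_deriv_eq {F : Type*} [Field F] (p : ℕ) [CharP F p] (δ : F) (t : ℕ)
    (G : Polynomial F) (a b : F) (ha : a ^ p = a) (hb : b ^ p = b) :
    (derivative (compSubstAS p δ t G)).eval a = (derivative (compSubstAS p δ t G)).eval b := by
  unfold compSubstAS
  simp [eval_finsetSum, ha, hb, derivative_pow]

theorem ratio_step {F : Type*} [Field F] (p n : ℕ) [CharP F p] (hp : p.Prime) (δ : F)
    (hδ : δ ≠ 0) (P0 : Polynomial F) (u : ℕ) :
    (derivative (FseqAS p δ n P0 (u + 2))).eval 1 / (FseqAS p δ n P0 (u + 2)).eval 1 =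
      (-δ⁻¹) * ((derivative (FseqAS p δ n P0 (u + 1))).eval 1 /
        (FseqAS p δ n P0 (u + 1)).eval 1) := by
  have h0 : (0 : F) ^ p = 0 := zero_pow hp.ne_zero
  have h1 : (1 : F) ^ p = 1 := one_pow p
  rcases Nat.eq_zero_or_pos n with rfl | hn
  · simp [FseqAS, compSubstAS]
  obtain ⟨s, hs⟩ : ∃ s, n * p ^ (u + 1) = s + 1 :=
    Nat.exists_eq_succ_of_ne_zero (Nat.mul_pos hn (pow_pos hp.pos _)).ne'
  have hsF : ((s + 1 : ℕ) : F) = 0 := by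
    rw [← hs]; simp [CharP.cast_eq_zero]
  have hc0 : (FseqAS p δ n P0 (u + 1)).coeff 0 = (FseqAS p δ n P0 (u + 1)).eval 1 := by
    rw [coeff_zero_eq_eval_zero]
    simp only [FseqAS]
    rw [cs_eval _ _ _ _ _ h0, cs_eval _ _ _ _ _ h1]
  have hc1 : (FseqAS p δ n P0 (u + 1)).coeff 1 =
      (derivative (FseqAS p δ n P0 (u + 1))).eval 1 := by
    have : (FseqAS p δ n P0 (u + 1)).coeff 1 =
      (derivative (FseqAS p δ n P0 (u + 1))).eval 0 := by
      rw [← coeff_zero_eq_eval_zero, coeff_derivative]; simp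
    rw [this]
    simp only [FseqAS]
    exact cs_deriv_eq _ _ _ _ _ _ h0 h1
  have e : FseqAS p δ n P0 (u + 2) = compSubstAS p δ (s + 1) (FseqAS p δ n P0 (u + 1)) := by
    rw [← hs, FseqAS]
  rw [e, cs_eval _ _ _ _ _ h1, cs_deriv _ _ _ hsF _ _ h1, hc0, hc1]
  by_cases hz : (FseqAS p δ n P0 (u + 1)).eval 1 = 0
  · simp [hz]
  · field_simp
    ring

theorem tr_smul {F : Type*} [Field F] (p m : ℕ) (c x : F) (hc : c ^ p = c) :
    TrQP p m (c * x) = c * TrQP p m x := by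
  have h : ∀ i, c ^ p ^ i = c := by
    intro i
    induction i with
    | zero => simp
    | succ k ih => rw [pow_succ, pow_mul, ih, hc]
  simp [TrQP, mul_pow, h, Finset.mul_sum]

/-- final trace identity in the proof of Theorem 3.2: with `q = p^m`,
`P` of degree `n` over `F_q` with reciprocal `P* = reflect n P` satisfying
`P*(0) ≠ 0`, `δ` a nonzero element of the prime field `F_p ⊆ F_q`, `F₀ = P*` and
`F_u = (x^p-x+δ)^{n·p^{u-1}} F_{u-1}((x^p-x)/(x^p-x+δ))` for `u ≥ 1`: for every
`u ≥ 1`, `Tr_{q|p}(F_u'(1)/F_u(1)) = (-1)^{u-1}·δ^{-(u-1)}·Tr_{q|p}(F₁'(1)/F₁(1))`. -/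
theorem trace_derivative_FseqAS
    {F : Type*} [Field F] [Fintype F] (p m n : ℕ) (hp : p.Prime) (hm : 0 < m)
    (hq : Fintype.card F = p ^ m)
    (P : Polynomial F) (hPdeg : P.natDegree = n) (hP0 : (reflect n P).eval 0 ≠ 0)
    (δ : F) (hδ : δ ≠ 0) (hδp : δ ^ p = δ) :
    ∀ u : ℕ, 1 ≤ u →
      TrQP p m ((Polynomial.derivative (FseqAS p δ n (reflect n P) u)).eval 1 /
          (FseqAS p δ n (reflect n P) u).eval 1) =
        (-1) ^ (u - 1) * (δ ^ (u - 1))⁻¹ *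
          TrQP p m ((Polynomial.derivative (FseqAS p δ n (reflect n P) 1)).eval 1 /
            (FseqAS p δ n (reflect n P) 1).eval 1) := by
  haveI : Fact p.Prime := ⟨hp⟩
  haveI : CharP F p := by
    obtain ⟨r, hr⟩ := CharP.exists F
    have hrp : r.Prime := CharP.char_is_prime F r
    have h : ((p ^ m : ℕ) : F) = 0 := by rw [← hq]; simp
    have h2 : r ∣ p := hrp.dvd_of_dvd_pow ((CharP.cast_eq_zero_iff F r _).1 h)
    rw [← (Nat.prime_dvd_prime_iff_eq hrp hp).1 h2]
    exact hr
  have hc : (-δ⁻¹) ^ p = -δ⁻¹ := by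
    have := map_neg (frobenius F p) δ⁻¹
    simpa [frobenius_def, hδp] using this
  intro u hu
  obtain ⟨k, rfl⟩ : ∃ k, u = k + 1 := ⟨u - 1, by omega⟩
  simp only [Nat.add_sub_cancel]
  clear hu
  induction k with
  | zero => simp
  | succ k ih =>
    rw [ratio_step p n hp δ hδ, tr_smul _ _ _ _ hc, ih]
    rw [pow_succ, pow_succ, mul_inv]
    ring
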